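/- Let (R, r) be a dévissage setup and let φ : R → R be a ring endomorphism with φ(r)R = rR. Let D be a finitely presented R-module with finite projective (r,μ)-dévissage and bounded r^∞-torsion, equipped with an additive map φ_D : D → D which is φ-semilinear (φ_D(x·d) = φ(x)·φ_D(d)) and étale, meaning that the R-linear map φ_D* : R ⊗_{φ,R} D → D, t ⊗ d ↦ t·φ_D(d), is bijective (here R ⊗_{φ,R} D is the base change of D along φ, viewed as R-module via the left factor). Then for every n ≥ 0: (a) φ_D maps rⁿD into rⁿD and the induced R-linear map R ⊗_{φ,R} (rⁿD) → rⁿD is bijective; (b) φ_D maps D[rⁿ] = {d | rⁿ·d = 0} into D[rⁿ] and the induced R-linear map R ⊗_{φ,R} (D[rⁿ]) → D[rⁿ] is bijective. -/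

import Mathlib

open Pointwise

universe u

section Core

variable {R : Type u} [CommRing R]

/-- A dévissage setup: `R` is `r`-torsion-free and `r`-adically complete and separated. -/
structure IsDevissageSetup (R : Type u) [CommRing R] (r : R) : Prop where
  torsionFree : ∀ x : R, r * x = 0 → x = 0
  adicComplete : IsAdicComplete (Ideal.span {r}) R

/-- `Q` has constant rank over `A`: localization at every prime is free of a fixed rank. -/
def ConstRank (A : Type u) [CommRing A] (Q : Type u) [AddCommGroup Q] [Module A Q] : Prop :=
  ∃ c : ℕ, ∀ (p : Ideal A) (_ : p.IsPrime),
    Nonempty ((LocalizedModule p.primeCompl Q) ≃ₗ[Localization.AtPrime p]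
      (Fin c → Localization.AtPrime p))

/-- finitely generated, projective, of constant rank -/
def FinProjConstRank (A : Type u) [CommRing A] (Q : Type u) [AddCommGroup Q] [Module A Q] : Prop :=
  Module.Finite A Q ∧ Module.Projective A Q ∧ ConstRank A Q

/-- the subquotient `rⁿM/rⁿ⁺¹M`, realized as a submodule of `M/rⁿ⁺¹M`. -/
def muQuotSub (r : R) (M : Type u) [AddCommGroup M] [Module R M] (n : ℕ) :
    Submodule R (M ⧸ (r ^ (n + 1) • (⊤ : Submodule R M))) :=
  (r ^ n • (⊤ : Submodule R M)).map (r ^ (n + 1) • (⊤ : Submodule R M)).mkQ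

theorem muQuotSub_isTorsionBySet (r : R) (M : Type u) [AddCommGroup M] [Module R M] (n : ℕ) :
    Module.IsTorsionBySet R (muQuotSub r M n) ((Ideal.span {r} : Ideal R) : Set R) := by
  refine (Module.isTorsionBySet_span_singleton_iff r).mpr ?_
  rintro ⟨x, hx⟩
  obtain ⟨m, hm, rfl⟩ := hx
  obtain ⟨m', -, rfl⟩ := hm
  apply Subtype.ext
  show r • ((r ^ (n + 1) • (⊤ : Submodule R M)).mkQ
      ((DistribMulAction.toLinearMap R M (r ^ n) : M →ₗ[R] M) m')) = 0
  rw [← map_smul]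
  rw [Submodule.mkQ_apply, Submodule.Quotient.mk_eq_zero]
  show r • r ^ n • m' ∈ r ^ (n + 1) • (⊤ : Submodule R M)
  rw [smul_smul, ← pow_succ']
  exact Submodule.smul_mem_pointwise_smul _ _ _ Submodule.mem_top

/-- `M` has finite projective `(r,μ)`-dévissage. -/
def HasFinProjMuDevissage (r : R) (M : Type u) [AddCommGroup M] [Module R M] : Prop :=
  ∀ n : ℕ,
    letI := (muQuotSub_isTorsionBySet r M n).module
    FinProjConstRank (R ⧸ (Ideal.span {r} : Ideal R)) (muQuotSub r M n)

/-- `M` has bounded `r^∞`-torsion. -/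
def BoundedRTorsion (r : R) (M : Type u) [AddCommGroup M] [Module R M] : Prop :=
  ∃ N : ℕ, 1 ≤ N ∧ ∀ x : M, (∃ k : ℕ, r ^ k • x = 0) → r ^ N • x = 0

end Core

section Twist

variable {R : Type u} [CommRing R]

/-- `D` viewed as an `R`-module through the ring endomorphism `φ`. -/
def Untwist (φ : R →+* R) (D : Type u) : Type u := D

instance (φ : R →+* R) (D : Type u) [AddCommGroup D] : AddCommGroup (Untwist φ D) :=
  inferInstanceAs (AddCommGroup D)

instance (φ : R →+* R) (D : Type u) [AddCommGroup D] [Module R D] :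
    Module R (Untwist φ D) := Module.compHom D φ

/-- the identity of `D`, viewed into the twist. -/
def Untwist.inj (φ : R →+* R) {D : Type u} (x : D) : Untwist φ D := x

/-- the identity of `D`, viewed out of the twist. -/
def Untwist.out (φ : R →+* R) {D : Type u} (x : Untwist φ D) : D := x

/-- the linearization `φ* f : R ⊗_{φ,R} D₁ → D₂`, `t ⊗ d ↦ t • f d`, of a `φ`-semilinear map
`f : D₁ → D₂`. -/
noncomputable def linz (φ : R →+* R) {D₁ D₂ : Type u} [AddCommGroup D₁] [Module R D₁]
    [AddCommGroup D₂] [Module R D₂] (f : D₁ →ₛₗ[φ] D₂) :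
    TensorProduct R (Untwist φ R) D₁ →ₗ[R] Untwist φ D₂ :=
  TensorProduct.lift
    (LinearMap.mk₂ R
      (fun (t : Untwist φ R) (d : D₁) => Untwist.inj φ (Untwist.out φ t • f d))
      (fun t t' d => add_smul (Untwist.out φ t) (Untwist.out φ t') (f d))
      (fun c t d => mul_smul (φ c) (Untwist.out φ t) (f d))
      (fun t d d' => by
        show Untwist.out φ t • f (d + d') = Untwist.out φ t • f d + Untwist.out φ t • f d'
        rw [map_add, smul_add])
      (fun c t d => by
        show Untwist.out φ t • f (c • d) = φ c • (Untwist.out φ t • f d)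
        rw [f.map_smulₛₗ]
        exact smul_comm _ _ _))

/-- restriction of a semilinear map to an invariant submodule. -/
def restrictSL (φ : R →+* R) {D : Type u} [AddCommGroup D] [Module R D]
    (f : D →ₛₗ[φ] D) (S : Submodule R D) (h : ∀ d ∈ S, f d ∈ S) : S →ₛₗ[φ] S where
  toFun d := ⟨f d, h d d.2⟩
  map_add' a b := Subtype.ext (f.map_add a b)
  map_smul' c a := Subtype.ext (f.map_smulₛₗ c a)

end Twist


section Helpers

variable {R : Type u} [CommRing R]

/-- `Tor₁(A, M) = 0`, phrased elementarily. -/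
def TorGood (A : Type u) [AddCommGroup A] [Module R A] (M : Type u) [AddCommGroup M]
    [Module R M] : Prop :=
  ∀ (X Y : Type u) [AddCommGroup X] [Module R X] [AddCommGroup Y] [Module R Y]
    (f : X →ₗ[R] Y) (p : Y →ₗ[R] M), Function.Injective f → Function.Exact f p →
    Function.Surjective p → Function.Injective (f.lTensor A)

theorem lTensor_inj_of_left_inv {A X Y : Type u} [AddCommGroup A] [Module R A]
    [AddCommGroup X] [Module R X] [AddCommGroup Y] [Module R Y] (f : X →ₗ[R] Y)
    (l : Y →ₗ[R] X) (h : l ∘ₗ f = LinearMap.id) : Function.Injective (f.lTensor A) := by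
  have : (l.lTensor A) ∘ₗ (f.lTensor A) = LinearMap.id := by
    rw [← LinearMap.lTensor_comp, h, LinearMap.lTensor_id]
  intro a b hab
  have h1 := LinearMap.congr_fun this a
  have h2 := LinearMap.congr_fun this b
  simp only [LinearMap.comp_apply, LinearMap.id_apply] at h1 h2
  rw [← h1, ← h2, hab]

theorem torGood_projective (A M : Type u) [AddCommGroup A] [Module R A] [AddCommGroup M]
    [Module R M] [Module.Projective R M] : TorGood (R := R) A M := by
  intro X Y _ _ _ _ f p hf he hp
  obtain ⟨s, hs⟩ := Module.projective_lifting_property p LinearMap.id hp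
  have hsp : Function.Injective f ∧ ∃ l, p ∘ₗ l = LinearMap.id := ⟨hf, s, hs⟩
  obtain ⟨-, l, hl⟩ := (he.split_tfae'.out 0 1 :
    _ ↔ Function.Surjective p ∧ ∃ l, l ∘ₗ f = LinearMap.id).1 hsp
  exact lTensor_inj_of_left_inv f l hl

theorem torGood_of_pres {A K F M : Type u} [AddCommGroup A] [Module R A] [AddCommGroup M]
    [Module R M] [AddCommGroup K] [Module R K] [AddCommGroup F] [Module R F]
    [Module.Projective R F] (k : K →ₗ[R] F) (q : F →ₗ[R] M) (hk : Function.Exact k q)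
    (hq : Function.Surjective q) (hinj : Function.Injective (k.lTensor A)) :
    TorGood (R := R) A M := by
  intro X Y _ _ _ _ f p hf he hp
  -- pullback
  let Z : Submodule R (Y × F) :=
    LinearMap.ker (p ∘ₗ LinearMap.fst R Y F - q ∘ₗ LinearMap.snd R Y F)
  have hZ : ∀ z : Y × F, z ∈ Z ↔ p z.1 = q z.2 := fun z => by
    simp [Z, LinearMap.mem_ker, sub_eq_zero]
  let iX : X →ₗ[R] Z := LinearMap.codRestrict Z (LinearMap.inl R Y F ∘ₗ f)
    (fun x => (hZ _).2 (by simp [he.apply_apply_eq_zero]))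
  let iK : K →ₗ[R] Z := LinearMap.codRestrict Z (LinearMap.inr R Y F ∘ₗ k)
    (fun x => (hZ _).2 (by simp [hk.apply_apply_eq_zero]))
  let pY : Z →ₗ[R] Y := LinearMap.fst R Y F ∘ₗ Z.subtype
  let pF : Z →ₗ[R] F := LinearMap.snd R Y F ∘ₗ Z.subtype
  have h1 : Function.Injective (iX.lTensor A) := by
    refine torGood_projective (R := R) A F X Z iX pF ?_ ?_ ?_
    · intro a b hab
      exact hf (congrArg (fun z : Z => z.1.1) hab)
    · rintro ⟨⟨y, w⟩, hz⟩
      have hz' := (hZ _).1 hz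
      constructor
      · intro h
        have hw : w = 0 := h
        subst hw
        obtain ⟨x, hx⟩ := (he y).1 (by simpa using hz')
        exact ⟨x, Subtype.ext (Prod.ext hx rfl)⟩
      · rintro ⟨x, hx⟩
        have := congrArg (fun z : Z => z.1.2) hx
        exact this.symm
    · intro w
      obtain ⟨y, hy⟩ := hp (q w)
      exact ⟨⟨(y, w), (hZ _).2 hy⟩, rfl⟩
  have h2 : Function.Exact iK pY := by
    rintro ⟨⟨y, w⟩, hz⟩
    have hz' := (hZ _).1 hz
    constructor
    · intro h
      have hw : y = 0 := h
      subst hw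
      obtain ⟨x, hx⟩ := (hk w).1 (by simpa using hz'.symm)
      exact ⟨x, Subtype.ext (Prod.ext rfl hx)⟩
    · rintro ⟨x, hx⟩
      have := congrArg (fun z : Z => z.1.1) hx
      exact this.symm
  have h3 : Function.Surjective pY := by
    intro y
    obtain ⟨w, hw⟩ := hq (p y)
    exact ⟨⟨(y, w), (hZ _).2 hw.symm⟩, rfl⟩
  have h4 := lTensor_exact A h2 h3
  have e1 : pY ∘ₗ iX = f := rfl
  have e2 : pF ∘ₗ iK = k := rfl
  have e3 : pF ∘ₗ iX = 0 := rfl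
  rw [injective_iff_map_eq_zero]
  intro x hx
  rw [← e1, LinearMap.lTensor_comp, LinearMap.comp_apply] at hx
  obtain ⟨c, hc⟩ := (h4 _).1 hx
  have h5 : k.lTensor A c = 0 := by
    rw [← e2, LinearMap.lTensor_comp, LinearMap.comp_apply, hc, ← LinearMap.comp_apply,
      ← LinearMap.lTensor_comp, e3, LinearMap.lTensor_zero, LinearMap.zero_apply]
  have h6 : c = 0 := hinj (by rw [h5, map_zero])
  apply h1
  rw [← hc, h6, map_zero, map_zero]

theorem torGood_retract {A M Q : Type u} [AddCommGroup A] [Module R A] [AddCommGroup M]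
    [Module R M] [AddCommGroup Q] [Module R Q] (s : Q →ₗ[R] M) (q : M →ₗ[R] Q)
    (hs : q ∘ₗ s = LinearMap.id) (hM : TorGood (R := R) A M) : TorGood (R := R) A Q := by
  intro X Y _ _ _ _ f p hf he hp
  let Z : Submodule R (Y × M) :=
    LinearMap.ker (p ∘ₗ LinearMap.fst R Y M - q ∘ₗ LinearMap.snd R Y M)
  have hZ : ∀ z : Y × M, z ∈ Z ↔ p z.1 = q z.2 := fun z => by
    simp [Z, LinearMap.mem_ker, sub_eq_zero]
  have hs' : ∀ x, q (s x) = x := fun x => LinearMap.congr_fun hs x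
  let iX : X →ₗ[R] Z := LinearMap.codRestrict Z (LinearMap.inl R Y M ∘ₗ f)
    (fun x => (hZ _).2 (by simp [he.apply_apply_eq_zero]))
  let pF : Z →ₗ[R] M := LinearMap.snd R Y M ∘ₗ Z.subtype
  let j : Y →ₗ[R] Z := LinearMap.codRestrict Z (LinearMap.prod LinearMap.id (s ∘ₗ p))
    (fun x => (hZ _).2 (by simp [hs']))
  have h1 : Function.Injective (iX.lTensor A) := by
    refine hM X Z iX pF ?_ ?_ ?_
    · intro a b hab
      exact hf (congrArg (fun z : Z => z.1.1) hab)
    · rintro ⟨⟨y, w⟩, hz⟩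
      have hz' := (hZ _).1 hz
      constructor
      · intro h
        have hw : w = 0 := h
        subst hw
        obtain ⟨x, hx⟩ := (he y).1 (by simpa using hz')
        exact ⟨x, Subtype.ext (Prod.ext hx rfl)⟩
      · rintro ⟨x, hx⟩
        have := congrArg (fun z : Z => z.1.2) hx
        exact this.symm
    · intro w
      obtain ⟨y, hy⟩ := hp (q w)
      exact ⟨⟨(y, w), (hZ _).2 hy⟩, rfl⟩
  have e : j ∘ₗ f = iX := by
    ext x
    · rfl
    · simp [j, iX, he.apply_apply_eq_zero]
  rw [← e, LinearMap.lTensor_comp, LinearMap.coe_comp] at h1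
  exact h1.of_comp

theorem torGood_ext {A M' M M'' : Type u} [AddCommGroup A] [Module R A] [AddCommGroup M]
    [Module R M] [AddCommGroup M'] [Module R M'] [AddCommGroup M''] [Module R M'']
    (i : M' →ₗ[R] M) (q : M →ₗ[R] M'') (hi : Function.Injective i) (hiq : Function.Exact i q)
    (hq : Function.Surjective q) (h' : TorGood (R := R) A M') (h'' : TorGood (R := R) A M'') :
    TorGood (R := R) A M := by
  intro X Y _ _ _ _ f p hf he hp
  let Y' : Submodule R Y := LinearMap.ker (q ∘ₗ p)
  have hY' : ∀ y, y ∈ Y' ↔ q (p y) = 0 := fun y => Iff.rfl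
  have h1 : Function.Injective (Y'.subtype.lTensor A) := by
    refine h'' Y' Y Y'.subtype (q ∘ₗ p) Subtype.val_injective ?_ (hq.comp hp)
    intro y
    simp [Y']
  let f' : X →ₗ[R] Y' := LinearMap.codRestrict Y' f
    (fun x => (hY' _).2 (by simp [he.apply_apply_eq_zero]))
  let e := LinearEquiv.ofInjective i hi
  let p0 : Y' →ₗ[R] LinearMap.range i := LinearMap.codRestrict _ (p ∘ₗ Y'.subtype)
    (fun y => (hiq _).1 y.2)
  have hip : ∀ y : Y', i (e.symm (p0 y)) = p y := by
    intro y
    have := congrArg Subtype.val (e.apply_symm_apply (p0 y))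
    exact this
  have h2 : Function.Injective (f'.lTensor A) := by
    refine h' X Y' f' (e.symm.toLinearMap ∘ₗ p0) ?_ ?_ ?_
    · intro a b hab
      exact hf (congrArg Subtype.val hab)
    · intro y
      constructor
      · intro h
        have h3 := hip y
        have h4 : e.symm (p0 y) = 0 := h
        rw [h4, map_zero] at h3
        obtain ⟨x, hx⟩ := (he _).1 h3.symm
        exact ⟨x, Subtype.ext hx⟩
      · rintro ⟨x, rfl⟩
        apply hi
        show i (e.symm (p0 (f' x))) = _
        rw [hip, map_zero]
        exact he.apply_apply_eq_zero x
    · intro m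
      obtain ⟨y, hy⟩ := hp (i m)
      refine ⟨⟨y, (hY' _).2 (by rw [hy, hiq.apply_apply_eq_zero])⟩, hi ?_⟩
      exact (hip _).trans hy
  have e1 : Y'.subtype ∘ₗ f' = f := rfl
  rw [← e1, LinearMap.lTensor_comp, LinearMap.coe_comp]
  exact h1.comp h2

/-- reduction `R^m → (R/r)^m` -/
def redPi (r : R) (m : ℕ) : (Fin m → R) →ₗ[R] (Fin m → R ⧸ (Ideal.span {r} : Ideal R)) :=
  LinearMap.pi fun i => (Submodule.mkQ (Ideal.span {r} : Ideal R)) ∘ₗ LinearMap.proj i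

theorem redPi_apply (r : R) (m : ℕ) (x : Fin m → R) (i : Fin m) :
    redPi r m x i = Ideal.Quotient.mk _ (x i) := rfl

theorem redPi_surj (r : R) (m : ℕ) : Function.Surjective (redPi r m) := by
  intro y
  choose x hx using fun i => Ideal.Quotient.mk_surjective (y i)
  exact ⟨x, funext hx⟩

theorem redPi_eq_zero (r : R) (m : ℕ) (x : Fin m → R) :
    redPi r m x = 0 ↔ ∃ y, x = r • y := by
  constructor
  · intro h
    have : ∀ i, ∃ c, x i = r * c := fun i => by
      have := congrFun h i
      rw [redPi_apply, Pi.zero_apply, Ideal.Quotient.eq_zero_iff_mem,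
        Ideal.mem_span_singleton] at this
      exact this
    choose y hy using this
    exact ⟨y, funext hy⟩
  · rintro ⟨y, rfl⟩
    ext i
    rw [redPi_apply, Pi.zero_apply, Ideal.Quotient.eq_zero_iff_mem, Ideal.mem_span_singleton]
    exact ⟨y i, rfl⟩

theorem torGood_modr (r : R) {A Q : Type u} [AddCommGroup A] [Module R A]
    (hA : ∀ a : A, r • a = 0 → a = 0) [AddCommGroup Q] [Module R Q]
    [Module (R ⧸ (Ideal.span {r} : Ideal R)) Q]
    [IsScalarTower R (R ⧸ (Ideal.span {r} : Ideal R)) Q]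
    [Module.Finite (R ⧸ (Ideal.span {r} : Ideal R)) Q]
    [Module.Projective (R ⧸ (Ideal.span {r} : Ideal R)) Q] : TorGood (R := R) A Q := by
  obtain ⟨m, f, hf⟩ := Module.Finite.exists_fin' (R ⧸ (Ideal.span {r} : Ideal R)) Q
  obtain ⟨s, hs⟩ := Module.projective_lifting_property f LinearMap.id hf
  refine torGood_retract (R := R) (s.restrictScalars R) (f.restrictScalars R) ?_ ?_
  · ext x
    exact LinearMap.congr_fun hs x
  · refine torGood_of_pres (R := R) (r • LinearMap.id : (Fin m → R) →ₗ[R] _) (redPi r m) ?_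
      (redPi_surj r m) ?_
    · intro x
      rw [redPi_eq_zero]
      constructor
      · rintro ⟨y, rfl⟩
        exact ⟨y, rfl⟩
      · rintro ⟨y, rfl⟩
        exact ⟨y, rfl⟩
    · have h1 : Function.Injective ((r • LinearMap.id : A →ₗ[R] A)) := by
        rw [injective_iff_map_eq_zero]
        exact hA
      have h2 := Module.Flat.rTensor_preserves_injective_linearMap (M := Fin m → R) _ h1
      rw [LinearMap.rTensor_smul, LinearMap.rTensor_id] at h2
      rw [LinearMap.lTensor_smul, LinearMap.lTensor_id]
      exact h2

theorem adic_sep {r : R} (hR : IsDevissageSetup R r) (x : R) (h : ∀ n, ∃ y, x = r ^ n * y) :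
    x = 0 := by
  have := hR.adicComplete
  refine IsHausdorff.haus this.toIsHausdorff x fun n => ?_
  rw [SModEq.zero, smul_eq_mul, Ideal.mul_top, Ideal.span_singleton_pow,
    Ideal.mem_span_singleton]
  exact h n

theorem adic_sum {r : R} (hR : IsDevissageSetup R r) (x : ℕ → R) :
    ∃ L, ∀ n, ∃ y, L = ∑ i ∈ Finset.range n, r ^ i * x i + r ^ n * y := by
  have := hR.adicComplete
  obtain ⟨L, hL⟩ := IsPrecomplete.prec this.toIsPrecomplete
    (f := fun n => ∑ i ∈ Finset.range n, r ^ i * x i) (by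
      intro m n hmn
      rw [SModEq.sub_mem, smul_eq_mul, Ideal.mul_top, Ideal.span_singleton_pow,
        Ideal.mem_span_singleton, dvd_sub_comm, ← Finset.sum_range_add_sum_Ico _ hmn,
        add_sub_cancel_left]
      refine Finset.dvd_sum fun i hi => ?_
      exact (pow_dvd_pow r (Finset.mem_Ico.1 hi).1).mul_right _)
  refine ⟨L, fun n => ?_⟩
  have h := (hL n).symm
  rw [SModEq.sub_mem, smul_eq_mul, Ideal.mul_top, Ideal.span_singleton_pow,
        Ideal.mem_span_singleton] at h
  obtain ⟨y, hy⟩ := h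
  exact ⟨y, by rw [← hy]; ring⟩

theorem pi_sep {r : R} (hR : IsDevissageSetup R r) {m : ℕ} (x : Fin m → R)
    (h : ∀ n : ℕ, ∃ y, x = r ^ n • y) : x = 0 := by
  ext i
  refine adic_sep hR _ fun n => ?_
  obtain ⟨y, hy⟩ := h n
  exact ⟨y i, congrFun hy i⟩

theorem pi_sum {r : R} (hR : IsDevissageSetup R r) {m : ℕ} (x : ℕ → Fin m → R) :
    ∃ L, ∀ n, ∃ y, L = ∑ i ∈ Finset.range n, r ^ i • x i + r ^ n • y := by
  choose L y hy using fun j => adic_sum hR (fun i => x i j)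
  refine ⟨L, fun n => ⟨fun j => y j n, ?_⟩⟩
  ext j
  simpa using hy j n

theorem torGood_lift {r : R} (hR : IsDevissageSetup R r) {A M Q : Type u} [AddCommGroup A]
    [Module R A] [AddCommGroup M] [Module R M] [Module.Finite R M]
    (htf : ∀ x : M, r • x = 0 → x = 0)
    [AddCommGroup Q] [Module R Q]
    [Module (R ⧸ (Ideal.span {r} : Ideal R)) Q]
    [IsScalarTower R (R ⧸ (Ideal.span {r} : Ideal R)) Q]
    [Module.Projective (R ⧸ (Ideal.span {r} : Ideal R)) Q]
    (π : M →ₗ[R] Q) (hπ : Function.Surjective π) (hker : ∀ x, π x = 0 ↔ ∃ y, x = r • y) :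
    TorGood (R := R) A M := by
  obtain ⟨m, p, hp⟩ := Module.Finite.exists_fin' R M
  let K := LinearMap.ker p
  -- the reduction of `π ∘ p`
  let fb : (Fin m → R ⧸ (Ideal.span {r} : Ideal R)) →ₗ[R ⧸ (Ideal.span {r} : Ideal R)] Q :=
    Fintype.linearCombination _ (fun i => π (p (Pi.single i 1)))
  have hfb : (fb.restrictScalars R) ∘ₗ redPi r m = π ∘ₗ p := by
    apply LinearMap.pi_ext'
    intro i
    ext
    have : redPi r m (Pi.single i 1) = Pi.single i 1 := by
      ext j
      rw [redPi_apply]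
      by_cases hij : j = i
      · subst hij; simp
      · simp [hij]
    simp [this, fb, Fintype.linearCombination_apply_single]
  have hfb' : ∀ x, fb (redPi r m x) = π (p x) := fun x => LinearMap.congr_fun hfb x
  have hfs : Function.Surjective fb := by
    intro y
    obtain ⟨x, hx⟩ := (hπ.comp hp) y
    exact ⟨redPi r m x, (hfb' x).trans hx⟩
  obtain ⟨s, hs⟩ := Module.projective_lifting_property fb LinearMap.id hfs
  have hs' : ∀ x, fb (s x) = x := fun x => LinearMap.congr_fun hs x
  -- `K` surjects on the kernel of `fb`
  have hKs : ∀ z, fb z = 0 → ∃ k : K, redPi r m k = z := by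
    intro z hz
    obtain ⟨x, rfl⟩ := redPi_surj r m z
    rw [hfb', hker] at hz
    obtain ⟨y, hy⟩ := hz
    obtain ⟨w, rfl⟩ := hp y
    refine ⟨⟨x - r • w, ?_⟩, ?_⟩
    · show p _ = 0
      rw [map_sub, hy, map_smul, sub_self]
    · have : redPi r m (r • w) = 0 := (redPi_eq_zero _ _ _).2 ⟨w, rfl⟩
      rw [map_sub, this, sub_zero]
  let kb : K →ₗ[R] LinearMap.ker (fb.restrictScalars R) :=
    LinearMap.codRestrict _ (redPi r m ∘ₗ K.subtype) (fun k => by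
      show fb (redPi r m k) = 0
      have : p k = 0 := k.2
      rw [hfb', this, map_zero])
  have hkb : Function.Surjective kb := by
    rintro ⟨z, hz⟩
    obtain ⟨k, hk⟩ := hKs z hz
    exact ⟨k, Subtype.ext hk⟩
  let e : (Fin m → R) →ₗ[R] LinearMap.ker (fb.restrictScalars R) :=
    LinearMap.codRestrict _ (redPi r m - (s.restrictScalars R) ∘ₗ π ∘ₗ p) (fun x => by
      show fb (redPi r m x - s (π (p x))) = 0
      rw [map_sub, hfb', hs', sub_self])
  obtain ⟨g, hg⟩ := Module.projective_lifting_property kb e hkb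
  have hg' : ∀ x, redPi r m (g x) = redPi r m x - s (π (p x)) := fun x =>
    congrArg Subtype.val (LinearMap.congr_fun hg x)
  have hgK : ∀ k : K, ∃ k' : K, (k : K) = g k + r • k' := by
    intro k
    have hk : p k = 0 := k.2
    have h1 : redPi r m ((k : Fin m → R) - g k) = 0 := by
      rw [map_sub, hg', hk, map_zero, map_zero, sub_zero, sub_self]
    obtain ⟨y, hy⟩ := (redPi_eq_zero _ _ _).1 h1
    have hy' : p y = 0 := by
      apply htf
      have h2 : p (g k) = 0 := (g k).2
      rw [← map_smul, ← hy, map_sub, hk, h2, sub_zero]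
    refine ⟨⟨y, hy'⟩, Subtype.ext ?_⟩
    show (k : Fin m → R) = g k + r • y
    rw [← hy]; abel
  -- `K = g(F)`
  have hgs : Function.Surjective g := by
    intro k
    choose nx hnx using hgK
    let ks : ℕ → K := fun n => nx^[n] k
    have hks : ∀ n, ks n = g (ks n) + r • ks (n + 1) := fun n => by
      simp only [ks, Function.iterate_succ_apply']
      exact hnx _
    have hsum : ∀ n, k = g (∑ i ∈ Finset.range n, r ^ i • (ks i : Fin m → R)) + r ^ n • ks n := by
      intro n
      induction n with
      | zero => simp [ks]
      | succ n ih =>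
        rw [Finset.sum_range_succ, map_add, map_smul, add_assoc, pow_succ, mul_smul, ← smul_add,
          ← hks]
        exact ih
    obtain ⟨L, hL⟩ := pi_sum hR (fun i => (ks i : Fin m → R))
    refine ⟨L, ?_⟩
    rw [← sub_eq_zero]
    apply Subtype.ext
    refine pi_sep hR _ fun n => ?_
    obtain ⟨y, hy⟩ := hL n
    refine ⟨(g y - ks n : K), ?_⟩
    have : g L - k = r ^ n • (g y - ks n) := by
      conv_lhs => rw [hsum n, hy]
      rw [map_add, map_smul, smul_sub]
      abel
    exact congrArg Subtype.val this
  have : Module.Finite R K := Module.Finite.of_surjective g hgs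
  let gK : K →ₗ[R] K := g ∘ₗ K.subtype
  have hgKs : Function.Surjective gK := by
    rw [← LinearMap.range_eq_top, ← top_le_iff]
    have := hR.adicComplete
    refine Submodule.le_of_le_smul_of_le_jacobson_bot (I := Ideal.span {r})
      Module.Finite.fg_top (IsAdicComplete.le_jacobson_bot _) ?_
    intro k _
    obtain ⟨k', hk'⟩ := hgK k
    rw [hk']
    refine Submodule.add_mem_sup ⟨k, rfl⟩ ?_
    exact Submodule.smul_mem_smul (Ideal.mem_span_singleton_self r) trivial
  have hgKb : Function.Bijective gK :=
    ⟨OrzechProperty.injective_of_surjective_endomorphism gK hgKs, hgKs⟩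
  let eK := LinearEquiv.ofBijective gK hgKb
  refine torGood_of_pres (R := R) K.subtype p ?_ hp ?_
  · intro x
    simp [K]
  · refine lTensor_inj_of_left_inv _ (eK.symm.toLinearMap ∘ₗ g) ?_
    ext1 k
    exact eK.symm_apply_apply k

section Dev

variable (r : R) (D : Type u) [AddCommGroup D] [Module R D]

theorem mem_rn (n : ℕ) (x : D) : x ∈ r ^ n • (⊤ : Submodule R D) ↔ ∃ d, x = r ^ n • d := by
  rw [Submodule.mem_smul_pointwise_iff_exists]
  simp [eq_comm]

theorem rn_le (n : ℕ) : r ^ (n + 1) • (⊤ : Submodule R D) ≤ r ^ n • (⊤ : Submodule R D) := by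
  intro x hx
  obtain ⟨d, rfl⟩ := (mem_rn r D _ _).1 hx
  exact (mem_rn r D _ _).2 ⟨r • d, by rw [smul_smul, pow_succ]⟩

/-- `rⁿD → rⁿD/rⁿ⁺¹D` -/
def toMu (n : ℕ) : (r ^ n • (⊤ : Submodule R D) : Submodule R D) →ₗ[R] muQuotSub r D n :=
  LinearMap.codRestrict _ ((r ^ (n + 1) • (⊤ : Submodule R D)).mkQ ∘ₗ Submodule.subtype _)
    (fun x => ⟨x, x.2, rfl⟩)

theorem toMu_surj (n : ℕ) : Function.Surjective (toMu r D n) := by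
  rintro ⟨x, y, hy, rfl⟩
  exact ⟨⟨y, hy⟩, rfl⟩

theorem toMu_eq_zero (n : ℕ) (x) : toMu r D n x = 0 ↔
    (x : D) ∈ r ^ (n + 1) • (⊤ : Submodule R D) := by
  rw [← Submodule.Quotient.mk_eq_zero, ← Subtype.coe_inj]
  rfl

theorem toMu_exact (n : ℕ) :
    Function.Exact (Submodule.inclusion (rn_le r D n)) (toMu r D n) := by
  intro x
  rw [toMu_eq_zero]
  constructor
  · intro h
    exact ⟨⟨x, h⟩, rfl⟩
  · rintro ⟨y, rfl⟩
    exact y.2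

variable {r D}

theorem torGood_mu {A : Type u} [AddCommGroup A] [Module R A]
    (hA : ∀ a : A, r • a = 0 → a = 0) (hdev : HasFinProjMuDevissage r D) (n : ℕ) :
    TorGood (R := R) A (muQuotSub r D n) := by
  letI := (muQuotSub_isTorsionBySet r D n).module
  haveI : IsScalarTower R (R ⧸ (Ideal.span {r} : Ideal R)) (muQuotSub r D n) :=
    (muQuotSub_isTorsionBySet r D n).isScalarTower
  obtain ⟨h1, h2, -⟩ := hdev n
  exact torGood_modr r hA

theorem torGood_rn (hR : IsDevissageSetup R r) {A : Type u} [AddCommGroup A] [Module R A]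
    (hA : ∀ a : A, r • a = 0 → a = 0) [Module.Finite R D] (hdev : HasFinProjMuDevissage r D)
    (hbd : BoundedRTorsion r D) (n : ℕ) :
    TorGood (R := R) A (r ^ n • (⊤ : Submodule R D) : Submodule R D) := by
  obtain ⟨N, -, hN⟩ := hbd
  have hlarge : ∀ n, N ≤ n →
      TorGood (R := R) A (r ^ n • (⊤ : Submodule R D) : Submodule R D) := by
    intro n hn
    letI := (muQuotSub_isTorsionBySet r D n).module
    haveI : IsScalarTower R (R ⧸ (Ideal.span {r} : Ideal R)) (muQuotSub r D n) :=
      (muQuotSub_isTorsionBySet r D n).isScalarTower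
    obtain ⟨h1, h2, -⟩ := hdev n
    haveI : Module.Finite R (r ^ n • (⊤ : Submodule R D) : Submodule R D) :=
      Module.Finite.iff_fg.2 (Submodule.FG.map _ Module.Finite.fg_top)
    refine torGood_lift hR ?_ (toMu r D n) (toMu_surj r D n) ?_
    · rintro ⟨x, hx⟩ h
      obtain ⟨d, rfl⟩ := (mem_rn r D _ _).1 hx
      have h' : r • r ^ n • d = 0 := congrArg Subtype.val h
      have hNd := hN d ⟨n + 1, by rw [pow_succ', mul_smul, h']⟩
      apply Subtype.ext
      show r ^ n • d = 0
      obtain ⟨k, rfl⟩ := Nat.exists_eq_add_of_le' hn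
      rw [pow_add, mul_smul, hNd, smul_zero]
    · intro x
      rw [toMu_eq_zero, mem_rn]
      constructor
      · rintro ⟨d, hd⟩
        refine ⟨⟨r ^ n • d, (mem_rn r D _ _).2 ⟨d, rfl⟩⟩, Subtype.ext ?_⟩
        rw [hd, pow_succ', mul_smul]; rfl
      · rintro ⟨y, rfl⟩
        obtain ⟨d, hd⟩ := (mem_rn r D _ _).1 y.2
        refine ⟨d, ?_⟩
        rw [pow_succ', mul_smul, ← hd]; rfl
  rcases le_total N n with h | h
  · exact hlarge n h
  · induction h using Nat.decreasingInduction with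
    | self => exact hlarge N le_rfl
    | of_succ k hk ih =>
      exact torGood_ext (Submodule.inclusion (rn_le r D k)) (toMu r D k)
        (Submodule.inclusion_injective _) (toMu_exact r D k) (toMu_surj r D k) ih
        (torGood_mu hA hdev k)

theorem rn_lTensor_inj {A : Type u} [AddCommGroup A] [Module R A]
    (hA : ∀ a : A, r • a = 0 → a = 0) (hdev : HasFinProjMuDevissage r D) (n : ℕ) :
    Function.Injective ((r ^ n • (⊤ : Submodule R D)).subtype.lTensor A) := by
  induction n with
  | zero =>
    refine lTensor_inj_of_left_inv _
      (LinearMap.codRestrict _ LinearMap.id (fun d => (mem_rn r D _ _).2 ⟨d, by simp⟩)) ?_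
    ext x
    rfl
  | succ n ih =>
    have h := torGood_mu hA hdev n _ _ (Submodule.inclusion (rn_le r D n)) (toMu r D n)
        (Submodule.inclusion_injective _) (toMu_exact r D n) (toMu_surj r D n)
    have e : (r ^ n • (⊤ : Submodule R D)).subtype ∘ₗ (Submodule.inclusion (rn_le r D n)) =
      (r ^ (n + 1) • (⊤ : Submodule R D)).subtype := rfl
    rw [← e, LinearMap.lTensor_comp, LinearMap.coe_comp]
    exact ih.comp h

end Dev

theorem linz_tmul (φ : R →+* R) {D₁ D₂ : Type u} [AddCommGroup D₁] [Module R D₁]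
    [AddCommGroup D₂] [Module R D₂] (f : D₁ →ₛₗ[φ] D₂) (t : Untwist φ R) (d : D₁) :
    linz φ f (TensorProduct.tmul R t d) = Untwist.inj φ (Untwist.out φ t • f d) := rfl

theorem linz_restrict (φ : R →+* R) {D : Type u} [AddCommGroup D] [Module R D]
    (f : D →ₛₗ[φ] D) (S : Submodule R D) (h : ∀ d ∈ S, f d ∈ S)
    (x : TensorProduct R (Untwist φ R) S) :
    (Untwist.out φ (linz φ f (S.subtype.lTensor (Untwist φ R) x))) =
      ((Untwist.out φ (linz φ (restrictSL φ f S h) x) : S) : D) := by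
  induction x using TensorProduct.induction_on with
  | zero => simp only [map_zero]; rfl
  | tmul t d => rfl
  | add a b ha hb =>
    simp only [map_add]
    exact congrArg₂ (· + ·) ha hb

theorem linz_restrict_inj (φ : R →+* R) {D : Type u} [AddCommGroup D] [Module R D]
    (f : D →ₛₗ[φ] D) (hf : Function.Bijective (linz φ f)) (S : Submodule R D)
    (h : ∀ d ∈ S, f d ∈ S)
    (hS : Function.Injective (S.subtype.lTensor (Untwist φ R))) :
    Function.Injective (linz φ (restrictSL φ f S h)) := by
  intro a b hab
  apply hS
  apply hf.1
  have h1 := linz_restrict φ f S h a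
  have h2 := linz_restrict φ f S h b
  rw [hab] at h1
  exact h1.trans h2.symm

/-- multiplication by `rⁿ` as a map `D → rⁿD` -/
def mulRn (r : R) (D : Type u) [AddCommGroup D] [Module R D] (n : ℕ) :
    D →ₗ[R] (r ^ n • (⊤ : Submodule R D) : Submodule R D) :=
  LinearMap.codRestrict _ (r ^ n • LinearMap.id) (fun d => (mem_rn r D _ _).2 ⟨d, rfl⟩)

theorem mulRn_surj (r : R) (D : Type u) [AddCommGroup D] [Module R D] (n : ℕ) :
    Function.Surjective (mulRn r D n) := by
  rintro ⟨x, hx⟩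
  obtain ⟨d, rfl⟩ := (mem_rn r D _ _).1 hx
  exact ⟨d, rfl⟩

theorem mulRn_exact (r : R) (D : Type u) [AddCommGroup D] [Module R D] (n : ℕ) :
    Function.Exact (Submodule.torsionBy R D (r ^ n)).subtype (mulRn r D n) := by
  intro x
  constructor
  · intro h
    have h' : r ^ n • x = 0 := congrArg Subtype.val h
    exact ⟨⟨x, h'⟩, rfl⟩
  · rintro ⟨y, rfl⟩
    exact Subtype.ext y.2

/-- `(rⁿ)·` is compatible with linearizations -/
theorem linz_mulRn (r : R) (φ : R →+* R) {D : Type u} [AddCommGroup D] [Module R D]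
    (f : D →ₛₗ[φ] D) (n : ℕ)
    (h : ∀ d ∈ (r ^ n • (⊤ : Submodule R D)), f d ∈ r ^ n • (⊤ : Submodule R D))
    (x : TensorProduct R (Untwist φ R) D) :
    ((Untwist.out φ (linz φ (restrictSL φ f _ h) ((mulRn r D n).lTensor _ x)) :
      (r ^ n • (⊤ : Submodule R D) : Submodule R D)) : D) =
      φ r ^ n • Untwist.out φ (linz φ f x) := by
  induction x using TensorProduct.induction_on with
  | zero =>
    simp only [map_zero]
    exact (smul_zero _).symm
  | tmul t d =>
    show Untwist.out φ t • f (r ^ n • d) = φ r ^ n • Untwist.out φ t • f d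
    rw [f.map_smulₛₗ, map_pow, smul_comm]
  | add a b ha hb =>
    simp only [map_add]
    exact (congrArg₂ (· + ·) ha hb).trans (smul_add _ _ _).symm

end Helpers

/-- Lemma `dev_etale`: for a dévissage setup `(R,r)`, a ring endomorphism `φ`
with `φ(r)R = rR`, and an étale `φ`-semilinear map `φ_D` on a finitely presented module `D` with
finite projective `(r,μ)`-dévissage and bounded `r^∞`-torsion, `φ_D` restricts to `rⁿD` and to
`D[rⁿ]` with bijective linearizations. -/
theorem etale_restricts_to_devissage {R : Type u} [CommRing R] (r : R)
    (hR : IsDevissageSetup R r) (φ : R →+* R)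
    (hφr : Ideal.span {φ r} = Ideal.span {r})
    (D : Type u) [AddCommGroup D] [Module R D]
    (hfp : Module.FinitePresentation R D) (hdev : HasFinProjMuDevissage r D)
    (hbd : BoundedRTorsion r D)
    (φD : D →ₛₗ[φ] D) (hetale : Function.Bijective (linz φ φD)) :
    (∀ n : ℕ, ∃ h : ∀ d ∈ (r ^ n • (⊤ : Submodule R D)), φD d ∈ r ^ n • (⊤ : Submodule R D),
      Function.Bijective (linz φ (restrictSL φ φD _ h))) ∧
    (∀ n : ℕ, ∃ h : ∀ d ∈ Submodule.torsionBy R D (r ^ n),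
        φD d ∈ Submodule.torsionBy R D (r ^ n),
      Function.Bijective (linz φ (restrictSL φ φD _ h))) := by
  have hu : ∃ u, φ r = r * u :=
    Ideal.mem_span_singleton.1 (hφr ▸ Ideal.mem_span_singleton_self (φ r))
  have hv : ∃ v, r = φ r * v :=
    Ideal.mem_span_singleton.1 (hφr.symm ▸ Ideal.mem_span_singleton_self r)
  obtain ⟨u, hu⟩ := hu
  obtain ⟨v, hv⟩ := hv
  have hA : ∀ a : Untwist φ R, r • a = 0 → a = 0 := by
    intro a ha
    have ha' : φ r * Untwist.out φ a = 0 := ha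
    apply hR.torsionFree (Untwist.out φ a)
    rw [hv, mul_right_comm, ha', zero_mul]
  have hfin : Module.Finite R D := inferInstance
  have hmem : ∀ n : ℕ, ∀ d ∈ (r ^ n • (⊤ : Submodule R D)),
      φD d ∈ r ^ n • (⊤ : Submodule R D) := by
    intro n d hd
    obtain ⟨d, rfl⟩ := (mem_rn r D _ _).1 hd
    rw [φD.map_smulₛₗ, map_pow, hu, mul_pow, mul_smul]
    exact (mem_rn r D _ _).2 ⟨_, rfl⟩
  have hinj : ∀ n, Function.Injective (linz φ (restrictSL φ φD _ (hmem n))) := fun n =>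
    linz_restrict_inj φ φD hetale _ _ (rn_lTensor_inj hA hdev n)
  refine ⟨fun n => ⟨hmem n, hinj n, ?_⟩, fun n => ?_⟩
  · intro y
    obtain ⟨d, hd⟩ := (mem_rn r D _ _).1 (Untwist.out φ y).2
    obtain ⟨x, hx⟩ := hetale.2 (Untwist.inj φ (v ^ n • d))
    refine ⟨(mulRn r D n).lTensor _ x, ?_⟩
    apply Subtype.ext
    refine (linz_mulRn r φ φD n (hmem n) x).trans ?_
    rw [hx]
    refine Eq.trans ?_ hd.symm
    show φ r ^ n • v ^ n • d = _
    rw [smul_smul, ← mul_pow, ← hv]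
  · have hmt : ∀ d ∈ Submodule.torsionBy R D (r ^ n),
        φD d ∈ Submodule.torsionBy R D (r ^ n) := by
      intro d hd
      rw [Submodule.mem_torsionBy_iff] at hd ⊢
      rw [hv, mul_pow, mul_comm, mul_smul, ← map_pow, ← φD.map_smulₛₗ, hd, map_zero, smul_zero]
    refine ⟨hmt, ?_, ?_⟩
    · refine linz_restrict_inj φ φD hetale _ _ ?_
      exact torGood_rn hR hA hdev hbd n _ _ _ (mulRn r D n) Subtype.val_injective
        (mulRn_exact r D n) (mulRn_surj r D n)
    · intro y
      obtain ⟨x, hx⟩ := hetale.2 (Untwist.inj φ ((Untwist.out φ y :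
        Submodule.torsionBy R D (r ^ n)) : D))
      have hy : r ^ n • ((Untwist.out φ y : Submodule.torsionBy R D (r ^ n)) : D) = 0 :=
        (Untwist.out φ y).2
      have h0 : (mulRn r D n).lTensor (Untwist φ R) x = 0 := by
        apply hinj n
        rw [map_zero]
        apply Subtype.ext
        refine (linz_mulRn r φ φD n (hmem n) x).trans ?_
        rw [hx]
        show φ r ^ n • ((Untwist.out φ y : Submodule.torsionBy R D (r ^ n)) : D) = 0
        rw [hu, mul_pow, mul_comm, mul_smul, hy, smul_zero]
      obtain ⟨w, hw⟩ := (lTensor_exact (Untwist φ R) (mulRn_exact r D n)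
        (mulRn_surj r D n) x).1 h0
      refine ⟨w, ?_⟩
      apply Subtype.ext
      refine (linz_restrict φ φD _ hmt w).symm.trans ?_
      rw [hw, hx]
      rfl
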